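/- arXiv:2112.13233 — 2 statements merged into one kernel-verified Lean document; each statement's English description precedes it below -/
import Mathlib

section
/- Let (X,f) be a topological dynamical system and B a basic set. For each minimal set M choose a point x_M ∈ B ∩ M. Then the closure of {x_M : M a minimal set} is contained in B and is itself a basic set. In particular, if B is a minimal basic set, then B equals the closure of {x_M : M a minimal set}. -/
open Set

/-- The full orbit `{fⁿ(x) : n ∈ ℤ}` of a point under a homeomorphism. -/
def orbitZ {X : Type*} [TopologicalSpace X] (f : X ≃ₜ X) (x : X) : Set X :=
  {y | ∃ n : ℤ, (f.toEquiv ^ n) x = y}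

/-- `O(A) = ⋃_{n ∈ ℤ} fⁿ(A)`. -/
def orbitSetZ {X : Type*} [TopologicalSpace X] (f : X ≃ₜ X) (A : Set X) : Set X :=
  ⋃ n : ℤ, (f.toEquiv ^ n) '' A

/-- `O⁺(A) = ⋃_{n ≥ 0} fⁿ(A)`. -/
def orbitSetP {X : Type*} [TopologicalSpace X] (f : X ≃ₜ X) (A : Set X) : Set X :=
  ⋃ n : ℕ, (f.toEquiv ^ (n : ℤ)) '' A

/-- `O⁻(A) = ⋃_{n ≤ 0} fⁿ(A)`. -/
def orbitSetN {X : Type*} [TopologicalSpace X] (f : X ≃ₜ X) (A : Set X) : Set X :=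
  ⋃ n : ℕ, (f.toEquiv ^ (-(n : ℤ))) '' A

/-- The ω-limit set of a point. -/
def omegaSet {X : Type*} [TopologicalSpace X] (f : X ≃ₜ X) (x : X) : Set X :=
  ⋂ n : ℕ, closure {y | ∃ m : ℕ, n ≤ m ∧ (f.toEquiv ^ (m : ℤ)) x = y}

/-- The α-limit set of a point. -/
def alphaSet {X : Type*} [TopologicalSpace X] (f : X ≃ₜ X) (x : X) : Set X :=
  ⋂ n : ℕ, closure {y | ∃ m : ℕ, n ≤ m ∧ (f.toEquiv ^ (-(m : ℤ))) x = y}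

/-- A minimal set: nonempty, closed, invariant, and every orbit in it is dense in it. -/
def IsMinimalSet {X : Type*} [TopologicalSpace X] (f : X ≃ₜ X) (M : Set X) : Prop :=
  M.Nonempty ∧ IsClosed M ∧ f '' M = M ∧ ∀ x ∈ M, M ⊆ closure (orbitZ f x)

/-- `M_f`: the closure of the union of all minimal sets. -/
def minimalUnion {X : Type*} [TopologicalSpace X] (f : X ≃ₜ X) : Set X :=
  closure (⋃₀ {M | IsMinimalSet f M})

/-- A wandering point. -/
def IsWandering {X : Type*} [TopologicalSpace X] (f : X ≃ₜ X) (x : X) : Prop :=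
  ∃ U : Set X, IsOpen U ∧ x ∈ U ∧ ∀ n : ℤ, n ≠ 0 → (f.toEquiv ^ n) '' U ∩ U = ∅

/-- `Ω_f`: the set of non-wandering points. -/
def nonWandering {X : Type*} [TopologicalSpace X] (f : X ≃ₜ X) : Set X :=
  {x | ¬ IsWandering f x}

/-- A quasi-section: a closed set every open neighborhood of which has full orbit. -/
def IsQuasiSection {X : Type*} [TopologicalSpace X] (f : X ≃ₜ X) (A : Set X) : Prop :=
  IsClosed A ∧ ∀ U : Set X, IsOpen U → A ⊆ U → orbitSetZ f U = Set.univ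

/-- A minimal quasi-section (minimal w.r.t. inclusion among quasi-sections). -/
def IsMinimalQuasiSection {X : Type*} [TopologicalSpace X] (f : X ≃ₜ X) (A : Set X) : Prop :=
  IsQuasiSection f A ∧ ∀ B : Set X, IsQuasiSection f B → B ⊆ A → B = A

/-- A basic set: a quasi-section meeting every orbit in at most one point. -/
def IsBasicSet {X : Type*} [TopologicalSpace X] (f : X ≃ₜ X) (A : Set X) : Prop :=
  IsQuasiSection f A ∧ ∀ x : X, (orbitZ f x ∩ A).Subsingleton

/-- A minimal basic set (minimal w.r.t. inclusion among basic sets). -/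
def IsMinimalBasicSet {X : Type*} [TopologicalSpace X] (f : X ≃ₜ X) (A : Set X) : Prop :=
  IsBasicSet f A ∧ ∀ B : Set X, IsBasicSet f B → B ⊆ A → B = A

/-- Densely aperiodic: the points with infinite orbit are dense. -/
def DenselyAperiodic {X : Type*} [TopologicalSpace X] (f : X ≃ₜ X) : Prop :=
  Dense {x : X | (orbitZ f x).Infinite}

theorem zpow_mem_of_preimage_eq {X : Type*} [TopologicalSpace X] {f : X ≃ₜ X} {K : Set X}
    (hK : f ⁻¹' K = K) (n : ℤ) {x : X} (hx : x ∈ K) : (f.toEquiv ^ n) x ∈ K := by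
  have key : ∀ y, f y ∈ K ↔ y ∈ K := fun y ↦ Set.ext_iff.1 hK y
  induction n with
  | zero => simpa using hx
  | succ n ih =>
    rw [add_comm, zpow_add, zpow_one]
    exact (key _).2 ih
  | pred n ih =>
    rw [← key]
    have h : f ((f.toEquiv ^ (-(n : ℤ) - 1)) x) = (f.toEquiv ^ (-(n : ℤ))) x := by
      change (f.toEquiv * f.toEquiv ^ (-(n : ℤ) - 1)) x = _
      rw [← zpow_one_add]; congr 2; ring
    rwa [h]

theorem preimage_orbitZ {X : Type*} [TopologicalSpace X] (f : X ≃ₜ X) (x : X) :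
    f ⁻¹' orbitZ f x = orbitZ f x := by
  ext y
  constructor
  · rintro ⟨n, hn⟩
    refine ⟨-1 + n, f.injective ?_⟩
    rw [zpow_add, zpow_neg_one, Equiv.Perm.mul_apply, hn]
    exact f.toEquiv.apply_symm_apply _
  · rintro ⟨n, rfl⟩
    refine ⟨1 + n, ?_⟩
    rw [zpow_add, zpow_one]
    rfl

theorem IsClosed.exists_isMinimalSet_subset {X : Type*} [TopologicalSpace X] [CompactSpace X]
    {f : X ≃ₜ X} {K : Set X} (hK : IsClosed K) (hne : K.Nonempty) (hinv : f ⁻¹' K = K) :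
    ∃ M ⊆ K, IsMinimalSet f M := by
  obtain ⟨M, hMK, hM⟩ := zorn_superset_nonempty
    {L : Set X | L.Nonempty ∧ IsClosed L ∧ f ⁻¹' L = L} (fun C hC hchain hCne ↦ by
      have := hCne.to_subtype
      have hdir : DirectedOn (· ⊇ ·) C := fun L hL L' hL' ↦
        (hchain.total hL hL').elim (fun h ↦ ⟨L, hL, subset_rfl, h⟩) fun h ↦ ⟨L', hL', h, subset_rfl⟩
      refine ⟨⋂₀ C, ⟨?_, isClosed_sInter fun L hL ↦ (hC hL).2.1, ?_⟩,
        fun L hL ↦ sInter_subset_of_mem hL⟩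
      · exact IsCompact.nonempty_sInter_of_directed_nonempty_isCompact_isClosed
          hdir (fun L hL ↦ (hC hL).1)
          (fun L hL ↦ (hC hL).2.1.isCompact) (fun L hL ↦ (hC hL).2.1)
      · rw [sInter_eq_biInter, preimage_iInter₂]
        exact iInter₂_congr fun L hL ↦ (hC hL).2.2) K ⟨hne, hK, hinv⟩
  obtain ⟨hMne, hMc, hMinv⟩ := hM.prop
  refine ⟨M, hMK, hMne, hMc, ?_, fun x hx ↦ ?_⟩
  · conv_lhs => rw [← hMinv]
    exact image_preimage_eq _ f.surjective
  · have horb : orbitZ f x ⊆ M := by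
      rintro _ ⟨n, rfl⟩
      exact zpow_mem_of_preimage_eq hMinv n hx
    refine hM.le_of_le ⟨⟨x, subset_closure ⟨0, rfl⟩⟩, isClosed_closure, ?_⟩
      (closure_minimal horb hMc)
    rw [f.preimage_closure, preimage_orbitZ]

theorem stmt9 {X : Type*} [TopologicalSpace X] [CompactSpace X] [T2Space X] [Nonempty X] (f : X ≃ₜ X)
    (B : Set X) (hB : IsBasicSet f B)
    (c : Set X → X) (hc : ∀ M : Set X, IsMinimalSet f M → c M ∈ B ∩ M) :
    closure (c '' {M | IsMinimalSet f M}) ⊆ B ∧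
    IsBasicSet f (closure (c '' {M | IsMinimalSet f M})) ∧
    (IsMinimalBasicSet f B → B = closure (c '' {M | IsMinimalSet f M})) := by
  have hsub : closure (c '' {M | IsMinimalSet f M}) ⊆ B :=
    closure_minimal (by rintro _ ⟨M, hM, rfl⟩; exact (hc M hM).1) hB.1.1
  have hbasic : IsBasicSet f (closure (c '' {M | IsMinimalSet f M})) := by
    refine ⟨⟨isClosed_closure, fun U hU hCU ↦ eq_univ_of_forall fun x ↦ ?_⟩,
      fun x ↦ (hB.2 x).anti (inter_subset_inter_right _ hsub)⟩
    obtain ⟨M, hMx, hM⟩ := (isClosed_closure (s := orbitZ f x)).exists_isMinimalSet_subset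
      (f := f) ⟨x, subset_closure ⟨0, rfl⟩⟩ (by rw [f.preimage_closure, preimage_orbitZ])
    obtain ⟨_, hyU, n, rfl⟩ := mem_closure_iff.1 (hMx (hc M hM).2) U hU
      (hCU (subset_closure ⟨M, hM, rfl⟩))
    exact mem_iUnion.2 ⟨-n, _, hyU, by rw [← Equiv.Perm.mul_apply, ← zpow_add]; simp⟩
  exact ⟨hsub, hbasic, fun h ↦ (h.2 _ hbasic hsub).symm⟩
end

section
/- Let (X,f) be a densely aperiodic topological dynamical system and B a basic set. Then B' := B \ int B is a continuously decisive basic set, i.e., B' is a basic set with empty interior. -/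
open Set

section Orbits

variable {X : Type*} [TopologicalSpace X] {f : X ≃ₜ X}

theorem continuous_toEquiv_zpow (f : X ≃ₜ X) (n : ℤ) : Continuous (f.toEquiv ^ n) := by
  have hpow (g : X ≃ₜ X) (k : ℕ) : Continuous (g.toEquiv ^ k) := by
    rw [Equiv.Perm.coe_pow]
    exact g.continuous.iterate k
  cases n with
  | ofNat k => simpa using hpow f k
  | negSucc k =>
    rw [zpow_negSucc, ← inv_pow]
    exact hpow f.symm (k + 1)

theorem isOpen_image_toEquiv_zpow (f : X ≃ₜ X) (n : ℤ) {U : Set X} (hU : IsOpen U) :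
    IsOpen ((f.toEquiv ^ n) '' U) := by
  rw [Equiv.image_eq_preimage_symm, ← Equiv.Perm.inv_def, ← zpow_neg]
  exact hU.preimage (continuous_toEquiv_zpow f (-n))

theorem isOpen_orbitSetZ (f : X ≃ₜ X) {U : Set X} (hU : IsOpen U) : IsOpen (orbitSetZ f U) :=
  isOpen_iUnion fun n => isOpen_image_toEquiv_zpow f n hU

theorem mem_orbitSetZ_iff {A : Set X} {x : X} :
    x ∈ orbitSetZ f A ↔ ∃ n : ℤ, (f.toEquiv ^ n) x ∈ A := by
  simp only [orbitSetZ, mem_iUnion, Equiv.image_eq_preimage_symm, ← Equiv.Perm.inv_def,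
    ← zpow_neg, mem_preimage]
  exact (Equiv.neg ℤ).exists_congr_left.trans (by simp)

theorem zpow_apply_mem_orbitSetZ_iff {A : Set X} {x : X} (n : ℤ) :
    (f.toEquiv ^ n) x ∈ orbitSetZ f A ↔ x ∈ orbitSetZ f A := by
  simp only [mem_orbitSetZ_iff, ← Equiv.Perm.mul_apply, ← zpow_add]
  exact ⟨fun ⟨m, hm⟩ => ⟨m + n, hm⟩, fun ⟨m, hm⟩ => ⟨m - n, by simpa using hm⟩⟩

theorem orbitSetZ_union (A C : Set X) :
    orbitSetZ f (A ∪ C) = orbitSetZ f A ∪ orbitSetZ f C := by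
  simp only [orbitSetZ, image_union, iUnion_union_distrib]

/-- A point of a set meeting every orbit at most once is fixed by any power of `f` that
returns it to the set. -/
theorem zpow_apply_eq_self {B : Set X} (hB : ∀ x, (orbitZ f x ∩ B).Subsingleton) {x : X}
    {n : ℤ} (hx : x ∈ B) (hn : (f.toEquiv ^ n) x ∈ B) : (f.toEquiv ^ n) x = x :=
  hB x ⟨⟨n, rfl⟩, hn⟩ ⟨⟨0, rfl⟩, hx⟩

theorem orbitZ_finite_of_zpow_apply_eq_self {x : X} {n : ℤ} (hn : n ≠ 0)
    (h : (f.toEquiv ^ n) x = x) : (orbitZ f x).Finite := by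
  refine ((finite_Ico 0 |n|).image fun m : ℤ => (f.toEquiv ^ m) x).subset ?_
  rintro _ ⟨m, rfl⟩
  refine ⟨m % n, ⟨Int.emod_nonneg m hn, Int.emod_lt_abs m hn⟩, ?_⟩
  conv_rhs => rw [← Int.emod_add_mul_ediv m n, zpow_add, Equiv.Perm.mul_apply, zpow_mul,
    Equiv.Perm.zpow_apply_eq_self_of_apply_eq_self h]

theorem exists_zpow_apply_eq_self_of_orbitZ_finite {x : X} (h : (orbitZ f x).Finite) :
    ∃ n : ℤ, n ≠ 0 ∧ (f.toEquiv ^ n) x = x := by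
  obtain ⟨m, -, n, -, hmn, he⟩ := infinite_univ.exists_ne_map_eq_of_mapsTo
    (f := fun n : ℤ => (f.toEquiv ^ n) x) (t := orbitZ f x) (fun n _ => ⟨n, rfl⟩) h
  refine ⟨-m + n, by omega, ?_⟩
  rw [zpow_add, Equiv.Perm.mul_apply, ← he, ← Equiv.Perm.mul_apply, ← zpow_add]
  simp

/-- In a densely aperiodic system, the interior of a set meeting every orbit at most once
consists of aperiodic points. -/
theorem orbitZ_infinite_of_mem_interior (hf : DenselyAperiodic f) {B : Set X}
    (hB : ∀ x, (orbitZ f x ∩ B).Subsingleton) {x : X} (hx : x ∈ interior B) :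
    (orbitZ f x).Infinite := by
  intro hfin
  obtain ⟨n, hn, hnx⟩ := exists_zpow_apply_eq_self_of_orbitZ_finite hfin
  obtain ⟨y, ⟨hy, hny⟩, hinf⟩ := hf.inter_open_nonempty
    (interior B ∩ (f.toEquiv ^ n) ⁻¹' interior B)
    (isOpen_interior.inter (isOpen_interior.preimage (continuous_toEquiv_zpow f n)))
    ⟨x, hx, by rwa [mem_preimage, hnx]⟩
  exact hinf (orbitZ_finite_of_zpow_apply_eq_self hn
    (zpow_apply_eq_self hB (interior_subset hy) (interior_subset hny)))

/-- If a compact set containing the orbit of a point of `W` is covered by the translates of the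
open set `W`, which meets every orbit at most once, then that orbit is finite. -/
theorem orbitZ_finite_of_isCompact_subset_orbitSetZ {W K : Set X} (hW : IsOpen W)
    (hWs : ∀ x, (orbitZ f x ∩ W).Subsingleton) (hK : IsCompact K) (hKW : K ⊆ orbitSetZ f W)
    {x : X} (hx : x ∈ W) (hxK : orbitZ f x ⊆ K) : (orbitZ f x).Finite := by
  obtain ⟨t, ht⟩ := hK.elim_finite_subcover _ (fun n => isOpen_image_toEquiv_zpow f n hW) hKW
  refine (t.finite_toSet.image fun n : ℤ => (f.toEquiv ^ n) x).subset ?_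
  rintro _ ⟨m, rfl⟩
  obtain ⟨n, hn, w, hw, hwm⟩ := mem_iUnion₂.1 (ht (hxK ⟨m, rfl⟩))
  have hwx : w = (f.toEquiv ^ (-n + m)) x := by
    rw [zpow_add, Equiv.Perm.mul_apply, ← hwm, ← Equiv.Perm.mul_apply, ← zpow_add]
    simp
  obtain rfl : w = x := hwx.trans (zpow_apply_eq_self hWs hx (hwx ▸ hw))
  exact ⟨n, hn, hwm⟩

end Orbits

theorem stmt13 {X : Type*} [TopologicalSpace X] [CompactSpace X] [T2Space X] [Nonempty X] (f : X ≃ₜ X)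
    (hf : DenselyAperiodic f)
    (B : Set X) (hB : IsBasicSet f B) :
    IsBasicSet f (B \ interior B) ∧ interior (B \ interior B) = ∅ := by
  obtain ⟨⟨hcl, hsec⟩, hsub⟩ := hB
  refine ⟨⟨⟨hcl.sdiff isOpen_interior, fun U hU hBU => ?_⟩,
    fun x => (hsub x).anti (inter_subset_inter_right _ sdiff_subset)⟩, ?_⟩
  · have hcover : orbitSetZ f U ∪ orbitSetZ f (interior B) = univ := by
      rw [← orbitSetZ_union]
      exact hsec _ (hU.union isOpen_interior) (sdiff_subset_iff.1 hBU |>.trans_eq (union_comm _ _))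
    by_contra hne
    obtain ⟨y, hy⟩ := (ne_univ_iff_exists_notMem _).1 hne
    have hKW : (orbitSetZ f U)ᶜ ⊆ orbitSetZ f (interior B) :=
      compl_subset_iff_union.2 hcover
    obtain ⟨n, hn⟩ := mem_orbitSetZ_iff.1 (hKW hy)
    refine orbitZ_infinite_of_mem_interior hf hsub hn
      (orbitZ_finite_of_isCompact_subset_orbitSetZ isOpen_interior
        (fun x => (hsub x).anti (inter_subset_inter_right _ interior_subset))
        (isOpen_orbitSetZ f hU).isClosed_compl.isCompact hKW hn ?_)
    rintro _ ⟨m, rfl⟩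
    rwa [mem_compl_iff, zpow_apply_mem_orbitSetZ_iff, zpow_apply_mem_orbitSetZ_iff]
  · exact eq_empty_of_forall_notMem fun x hx =>
      (interior_subset hx).2 (interior_mono sdiff_subset hx)
end
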